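/- Assuming the Robertson–Seymour–Thomas structure theorem — for an infinite cardinal κ, a graph G contains no subdivision of K_κ as a subgraph if and only if G admits a well-founded tree-decomposition of width < κ — the weak Hadwiger conjecture holds for infinite κ: if G has no proper coloring with κ colors, then K_κ is a minor of G. -/

import Mathlib

universe u

def TreeInf (T : Type u) [PartialOrder T] (inf : T → T → T) : Prop :=
  ∀ t1 t2 : T, inf t1 t2 ≤ t1 ∧ inf t1 t2 ≤ t2 ∧ ∀ s : T, s ≤ t1 → s ≤ t2 → s ≤ inf t1 t2

def WFTree (T : Type u) [PartialOrder T] (inf : T → T → T) : Prop :=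
  Nonempty T ∧ TreeInf T inf ∧
    ∀ t : T, IsWellOrder {t' : T // t' < t} (fun a b => a.1 < b.1)

/-- `T[t1,t2] = {t : t ≥ inf{t1,t2} and (t ≤ t1 or t ≤ t2)}`. -/
def treeInterval {T : Type u} [PartialOrder T] (inf : T → T → T) (t1 t2 : T) : Set T :=
  {t | inf t1 t2 ≤ t ∧ (t ≤ t1 ∨ t ≤ t2)}

/-- A well-founded tree-decomposition of the graph `G`, with bags `W`. -/
def WFTreeDecomp {V T : Type u} [PartialOrder T] (inf : T → T → T)
    (G : SimpleGraph V) (W : T → Set V) : Prop :=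
  WFTree T inf ∧
  -- (W1): every vertex lies in some bag, every edge lies in some single bag
  (∀ v : V, ∃ t : T, v ∈ W t) ∧
  (∀ u v : V, G.Adj u v → ∃ t : T, u ∈ W t ∧ v ∈ W t) ∧
  -- (W2)
  (∀ t1 t2 t' : T, t' ∈ treeInterval inf t1 t2 → W t1 ∩ W t2 ⊆ W t') ∧
  -- (W3)
  (∀ C : Set T, C.Nonempty → IsChain (· ≤ ·) C → ∀ c : T, IsLUB C c →
    (⋂ t ∈ C, W t) ⊆ W c)

/-- `G` has a complete minor with branch sets indexed by `ι`. -/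
def HasCompleteMinor {V : Type u} (G : SimpleGraph V) (ι : Type*) : Prop :=
  ∃ S : ι → Set V,
    (∀ i, (S i).Nonempty) ∧
    (∀ i, (G.induce (S i)).Connected) ∧
    (Pairwise fun i j => Disjoint (S i) (S j)) ∧
    (Pairwise fun i j => ∃ u ∈ S i, ∃ v ∈ S j, G.Adj u v)

def HasCompleteTopMinor {V : Type u} (G : SimpleGraph V) (ι : Type*) : Prop :=
  ∃ v : ι → V, Function.Injective v ∧
    ∃ P : ∀ i j : ι, G.Walk (v i) (v j),
      (∀ i j : ι, i ≠ j → (P i j).IsPath) ∧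
      (∀ i j : ι, i ≠ j → ∀ x ∈ (P i j).support, x ∉ Set.range v →
        ∀ k l : ι, k ≠ l → (k, l) ≠ (i, j) → (k, l) ≠ (j, i) →
          x ∉ (P k l).support)

/-- The tree-decomposition `(T, W)` has width `< κ`. -/
def WidthLT {V T : Type u} [PartialOrder T] (W : T → Set V) (κ : Cardinal.{u}) : Prop :=
  ∀ C : Set T, IsChain (· ≤ ·) C →
    Cardinal.mk (⋃ t ∈ C, ⋂ t' ∈ {s ∈ C | t ≤ s}, W t' : Set V) < κ

open Cardinal in
theorem wh_wf_choice {ι : Type*} {β : Type*} {lt : ι → ι → Prop} (wf : WellFounded lt)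
    (P : ∀ i, (∀ j, lt j i → β) → β → Prop) (h : ∀ i f, ∃ x, P i f x) :
    ∃ g : ι → β, ∀ i, P i (fun j _ => g j) (g i) := by
  choose Φ hΦ using h
  refine ⟨wf.fix Φ, fun i => ?_⟩
  have := hΦ i (fun j _ => wf.fix Φ j)
  rw [← wf.fix_eq Φ i] at this
  exact this

open Cardinal in
theorem wh_inj_choice {ι V : Type u} (S : ι → Set V) (κ : Cardinal.{u}) (hι : #ι ≤ κ)
    (hS : ∀ i, κ < #(S i)) : ∃ m : ι → V, Function.Injective m ∧ ∀ i, m i ∈ S i := by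
  obtain ⟨m, hm⟩ := wh_wf_choice (β := V) (lt := WellOrderingRel (α := ι))
    IsWellFounded.wf (fun i f x => x ∈ S i ∧ ∀ j hj, x ≠ f j hj) (by
      intro i f
      by_contra hcon
      push Not at hcon
      have hsub : S i ⊆ Set.range (fun j : {j // WellOrderingRel j i} => f j.1 j.2) := by
        intro x hx
        obtain ⟨j, hj, e⟩ := hcon x hx
        exact ⟨⟨j, hj⟩, e.symm⟩
      have h1 := (mk_le_mk_of_subset hsub).trans mk_range_le
      exact absurd ((h1.trans (mk_subtype_le _)).trans hι) (not_le.2 (hS i)))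
  refine ⟨m, ?_, fun i => (hm i).1⟩
  intro i j e
  rcases trichotomous_of (WellOrderingRel (α := ι)) i j with h | h | h
  · exact absurd e.symm ((hm j).2 i h)
  · exact h
  · exact absurd e ((hm i).2 j h)

open Cardinal in
theorem wh_minor {V : Type u} (G : SimpleGraph V) (κ : Cardinal.{u}) (hκ : ℵ₀ ≤ κ)
    (a : κ.out → V) (ha : Function.Injective a)
    (hN : ∀ i j, i ≠ j → κ < #{x | G.Adj (a i) x ∧ G.Adj (a j) x}) :
    HasCompleteMinor G κ.out := by
  let ι := {p : κ.out × κ.out // p.1 ≠ p.2}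
  have hι : #ι ≤ κ := by
    refine (mk_subtype_le _).trans ?_
    simp [mul_eq_self hκ]
  obtain ⟨m, hm, hmS⟩ := wh_inj_choice
    (fun p : ι => {x | G.Adj (a p.1.1) x ∧ G.Adj (a p.1.2) x} \ Set.range a) κ hι (by
      intro p
      by_contra hcon
      rw [not_lt] at hcon
      have h1 : #(Set.range a) ≤ κ := mk_range_le.trans (by simp)
      have h2 : {x | G.Adj (a p.1.1) x ∧ G.Adj (a p.1.2) x} ⊆
        ({x | G.Adj (a p.1.1) x ∧ G.Adj (a p.1.2) x} \ Set.range a) ∪ Set.range a := by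
        intro x hx
        by_cases h : x ∈ Set.range a
        · exact Or.inr h
        · exact Or.inl ⟨hx, h⟩
      have h3 := ((mk_le_mk_of_subset h2).trans (mk_union_le _ _)).trans
        (add_le_of_le hκ hcon h1)
      exact absurd h3 (not_le.2 (hN _ _ p.2)))
  refine ⟨fun i => {x | x = a i ∨ ∃ p : ι, p.1.1 = i ∧ x = m p}, fun i => ⟨a i, Or.inl rfl⟩,
    ?_, ?_, ?_⟩
  · intro i
    rw [SimpleGraph.connected_iff_exists_forall_reachable]
    refine ⟨⟨a i, Or.inl rfl⟩, ?_⟩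
    rintro ⟨x, rfl | ⟨p, rfl, rfl⟩⟩
    · exact SimpleGraph.Reachable.refl _
    · apply SimpleGraph.Adj.reachable
      exact (hmS p).1.1
  · intro i j hij
    rw [Set.disjoint_left]
    rintro x (rfl | ⟨p, rfl, rfl⟩) (h | ⟨q, hq, h⟩)
    · exact hij (ha h)
    · exact (hmS q).2 ⟨_, h⟩
    · exact (hmS p).2 ⟨_, h.symm⟩
    · exact hij (by rw [hm h]; exact hq)
  · intro i j hij
    exact ⟨m ⟨(i, j), hij⟩, Or.inr ⟨_, rfl, rfl⟩, a j, Or.inl rfl, (hmS ⟨(i, j), hij⟩).1.2.symm⟩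

open Cardinal in
def WhLC {V : Type u} (G : SimpleGraph V) (κ : Cardinal.{u}) (X : Set V) : Prop :=
  ∀ F : V → Set κ.out, (∀ v ∈ X, #(F v) < κ) →
    ∃ c : V → κ.out, ∀ v ∈ X, c v ∉ F v ∧ ∀ u ∈ X, G.Adj u v → c u ≠ c v

open Cardinal in
theorem wh_LC_of_levels {V ι : Type u} [LinearOrder ι] [WellFoundedLT ι] (G : SimpleGraph V)
    (κ : Cardinal.{u}) (hκ : ℵ₀ ≤ κ) (X : Set V) (r : V → ι)
    (h1 : ∀ i, WhLC G κ {v | v ∈ X ∧ r v = i})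
    (h2 : ∀ v ∈ X, #{u | u ∈ X ∧ G.Adj u v ∧ r u < r v} < κ) : WhLC G κ X := by
  intro F hF
  obtain ⟨g, hg⟩ := wh_wf_choice (β := V → κ.out) (lt := ((· < ·) : ι → ι → Prop))
    IsWellFounded.wf (fun i f x => ∀ v ∈ X, r v = i → x v ∉ F v ∧
      (∀ u ∈ X, G.Adj u v → ∀ h : r u < i, f (r u) h u ≠ x v) ∧
      (∀ u ∈ X, r u = i → G.Adj u v → x u ≠ x v)) (by
      intro i f
      obtain ⟨c, hc⟩ := h1 i (fun v => F v ∪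
        Set.range (fun u : {u | u ∈ X ∧ G.Adj u v ∧ r u < i} => f (r u.1) u.2.2.2 u.1)) (by
        rintro v ⟨hv, rfl⟩
        exact (mk_union_le _ _).trans_lt
          (add_lt_of_lt hκ (hF v hv) (mk_range_le.trans_lt (h2 v hv))))
      refine ⟨c, fun v hv hr => ⟨fun h => (hc v ⟨hv, hr⟩).1 (Or.inl h), ?_, ?_⟩⟩
      · intro u hu huv h e
        exact (hc v ⟨hv, hr⟩).1 (Or.inr ⟨⟨u, hu, huv, h⟩, e⟩)
      · intro u hu hur huv
        exact (hc v ⟨hv, hr⟩).2 u ⟨hu, hur⟩ huv)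
  refine ⟨fun v => g (r v) v, fun v hv => ⟨(hg _ v hv rfl).1, ?_⟩⟩
  intro u hu huv
  rcases lt_trichotomy (r u) (r v) with h | h | h
  · exact (hg _ v hv rfl).2.1 u hu huv h
  · have := (hg _ v hv rfl).2.2 u hu h huv
    simpa only [h] using this
  · exact ((hg _ u hu rfl).2.1 v hv huv.symm h).symm

open Cardinal in
theorem wh_LC_sub {V : Type u} (G : SimpleGraph V) (κ : Cardinal.{u}) (hκ : ℵ₀ ≤ κ)
    (X : Set V) (hX : X.Subsingleton) : WhLC G κ X := by
  intro F hF
  have hne : Nonempty κ.out := by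
    rw [← mk_ne_zero_iff, mk_out]
    exact (aleph0_pos.trans_le hκ).ne'
  have : ∀ v, ∃ k : κ.out, v ∈ X → k ∉ F v := by
    intro v
    by_contra hcon
    push Not at hcon
    have h3 := hF v (hcon hne.some).1
    rw [Set.eq_univ_of_forall fun k => (hcon k).2] at h3
    simp at h3
  choose c hc using this
  refine ⟨c, fun v hv => ⟨hc v hv, fun u hu huv => ?_⟩⟩
  rw [hX hu hv] at huv
  exact absurd huv (G.loopless.irrefl v)

open Cardinal in
def WhClosed {V : Type u} (G : SimpleGraph V) (κ : Cardinal.{u}) (X : Set V) : Prop :=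
  ∀ a ∈ X, ∀ b ∈ X, #{x | G.Adj a x ∧ G.Adj b x} ≤ κ → {x | G.Adj a x ∧ G.Adj b x} ⊆ X

open Cardinal in
def whStep {V : Type u} (G : SimpleGraph V) (κ : Cardinal.{u}) (X : Set V) : Set V :=
  X ∪ ⋃ p : {p : X × X // #{x | G.Adj p.1.1 x ∧ G.Adj p.2.1 x} ≤ κ},
    {x | G.Adj p.1.1.1 x ∧ G.Adj p.1.2.1 x}

def whCl {V : Type u} (G : SimpleGraph V) (κ : Cardinal.{u}) (X : Set V) : Set V :=
  ⋃ n : ℕ, (whStep G κ)^[n] X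

open Cardinal in
theorem whStep_card {V : Type u} (G : SimpleGraph V) (κ μ : Cardinal.{u}) (hκ : ℵ₀ ≤ κ)
    (hμ : κ ≤ μ) (X : Set V) (hX : #X ≤ μ) : #(whStep G κ X) ≤ μ := by
  have hμ0 := hκ.trans hμ
  refine (mk_union_le _ _).trans (add_le_of_le hμ0 hX ?_)
  refine (mk_iUnion_le _).trans ?_
  refine (mul_le_mul' (b := μ) (d := μ) ?_ ?_).trans (mul_eq_self hμ0).le
  · refine (mk_subtype_le _).trans ?_
    rw [mk_prod, lift_id]
    exact (mul_le_mul' hX hX).trans (mul_eq_self hμ0).le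
  · exact ciSup_le' fun p => p.2.trans hμ

open Cardinal in
theorem whCl_card {V : Type u} (G : SimpleGraph V) (κ μ : Cardinal.{u}) (hκ : ℵ₀ ≤ κ)
    (hμ : κ ≤ μ) (X : Set V) (hX : #X ≤ μ) : #(whCl G κ X) ≤ μ := by
  have hn : ∀ n : ℕ, #((whStep G κ)^[n] X : Set V) ≤ μ := by
    intro n
    induction n with
    | zero => exact hX
    | succ n ih =>
      rw [Function.iterate_succ_apply']
      exact whStep_card G κ μ hκ hμ _ ih
  have hμ0 := hκ.trans hμ
  have h := mk_iUnion_le_lift (fun n : ℕ => (whStep G κ)^[n] X)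
  rw [lift_id'.{0, u}] at h
  refine h.trans ?_
  refine (mul_le_mul' (b := μ) (d := μ) ?_ ?_).trans (mul_eq_self hμ0).le
  · simpa using hμ0
  · exact ciSup_le' fun p => by simpa using hn p

theorem whStep_mono {V : Type u} (G : SimpleGraph V) (κ : Cardinal.{u}) {X Y : Set V}
    (h : X ⊆ Y) : whStep G κ X ⊆ whStep G κ Y := by
  rintro x (hx | hx)
  · exact Or.inl (h hx)
  · obtain ⟨⟨⟨a, b⟩, hp⟩, hx⟩ := Set.mem_iUnion.1 hx
    exact Or.inr (Set.mem_iUnion.2 ⟨⟨⟨⟨a, h a.2⟩, ⟨b, h b.2⟩⟩, hp⟩, hx⟩)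

theorem whCl_mono {V : Type u} (G : SimpleGraph V) (κ : Cardinal.{u}) {X Y : Set V}
    (h : X ⊆ Y) : whCl G κ X ⊆ whCl G κ Y := by
  refine Set.iUnion_mono fun n => ?_
  induction n with
  | zero => exact h
  | succ n ih =>
    rw [Function.iterate_succ_apply', Function.iterate_succ_apply']
    exact whStep_mono G κ ih

theorem subset_whCl {V : Type u} (G : SimpleGraph V) (κ : Cardinal.{u}) (X : Set V) :
    X ⊆ whCl G κ X := fun _ hx => Set.mem_iUnion.2 ⟨0, hx⟩

theorem whCl_closed {V : Type u} (G : SimpleGraph V) (κ : Cardinal.{u}) (X : Set V) :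
    WhClosed G κ (whCl G κ X) := by
  intro a ha b hb hab x hx
  obtain ⟨n, hn⟩ := Set.mem_iUnion.1 ha
  obtain ⟨k, hk⟩ := Set.mem_iUnion.1 hb
  have hm : Monotone (fun n : ℕ => (whStep G κ)^[n] X) := by
    refine monotone_nat_of_le_succ fun n => ?_
    change (whStep G κ)^[n] X ⊆ (whStep G κ)^[n+1] X
    rw [Function.iterate_succ_apply']
    exact fun y hy => Or.inl hy
  refine Set.mem_iUnion.2 ⟨max n k + 1, ?_⟩
  rw [Function.iterate_succ_apply']
  exact Or.inr (Set.mem_iUnion.2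
    ⟨⟨⟨⟨a, hm (le_max_left n k) hn⟩, ⟨b, hm (le_max_right n k) hk⟩⟩, hab⟩, hx⟩)

open Cardinal in
theorem wh_small {V : Type u} (G : SimpleGraph V) (κ : Cardinal.{u}) (hκ : ℵ₀ ≤ κ)
    (hno : ¬ HasCompleteMinor G κ.out) (X : Set V) (hX : WhClosed G κ X) (v : V) (hv : v ∉ X) :
    #{u | u ∈ X ∧ G.Adj u v} < κ := by
  by_contra hcon
  rw [not_lt] at hcon
  have hcon' : #κ.out ≤ #{u | u ∈ X ∧ G.Adj u v} := by rwa [mk_out]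
  obtain ⟨f⟩ := hcon'
  refine hno (wh_minor G κ hκ (fun i => (f i).1)
    (fun i j h => f.injective (Subtype.ext h)) ?_)
  intro i j _
  by_contra h
  rw [not_lt] at h
  exact hv (hX _ (f i).2.1 _ (f j).2.1 h ⟨(f i).2.2, (f j).2.2⟩)

open Cardinal in
theorem wh_LC {V : Type u} (G : SimpleGraph V) (κ : Cardinal.{u}) (hκ : ℵ₀ ≤ κ)
    (hno : ¬ HasCompleteMinor G κ.out) (μ : Cardinal.{u}) :
    ∀ X : Set V, #X = μ → WhLC G κ X := by
  induction μ using WellFoundedLT.induction with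
  | ind μ ih =>
  intro X hX
  rcases X.eq_empty_or_nonempty with rfl | hne
  · exact wh_LC_sub G κ hκ _ Set.subsingleton_empty
  have hcard : #X = #μ.ord.ToType := by rw [mk_ord_toType, hX]
  obtain ⟨e⟩ := Cardinal.eq.1 hcard
  have hIio : ∀ i : μ.ord.ToType, #(Set.Iio i) < μ := fun i => mk_Iio_toType_ord_lt i
  obtain ⟨x0, hx0⟩ := hne
  rcases le_or_gt μ κ with hμ | hμ
  · classical
    let r : V → μ.ord.ToType := fun v => if h : v ∈ X then e ⟨v, h⟩ else e ⟨x0, hx0⟩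
    have hr : ∀ v (h : v ∈ X), r v = e ⟨v, h⟩ := fun v h => dif_pos h
    refine wh_LC_of_levels G κ hκ X r ?_ ?_
    · intro i
      refine wh_LC_sub G κ hκ _ ?_
      rintro u ⟨hu, rfl⟩ v ⟨hv, h⟩
      rw [hr u hu, hr v hv] at h
      exact (congrArg Subtype.val (e.injective h)).symm
    · intro v hv
      refine lt_of_le_of_lt ?_ ((hIio (r v)).trans_le hμ)
      refine mk_le_of_injective
        (f := fun u : {u | u ∈ X ∧ G.Adj u v ∧ r u < r v} => (⟨r u.1, u.2.2.2⟩ : Set.Iio (r v))) ?_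
      intro u w h
      have h' : r u.1 = r w.1 := congrArg Subtype.val h
      rw [hr _ u.2.1, hr _ w.2.1] at h'
      have h2 := e.injective h'
      exact Subtype.ext (Subtype.mk.inj h2)
  · let D : μ.ord.ToType → Set V := fun i => whCl G κ ((fun j => (e.symm j).1) '' Set.Iic i)
    have hDm : Monotone D := fun i j h => whCl_mono G κ (Set.image_mono (Set.Iic_subset_Iic.2 h))
    have hDX : ∀ v (h : v ∈ X), v ∈ D (e ⟨v, h⟩) := fun v h =>
      subset_whCl G κ _ ⟨e ⟨v, h⟩, Set.mem_Iic.2 (le_refl _), by simp⟩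
    have hD : ∀ v, ∃ i, v ∈ X → v ∈ D i ∧ ∀ j, v ∈ D j → i ≤ j := by
      intro v
      by_cases h : v ∈ X
      · have hne : {i | v ∈ D i}.Nonempty := ⟨_, hDX v h⟩
        refine ⟨WellFounded.min (wellFounded_lt (α := μ.ord.ToType)) _ hne, fun _ => ⟨WellFounded.min_mem _ _ hne, ?_⟩⟩
        intro j hj
        exact not_lt.1 (WellFounded.not_lt_min _ {i | v ∈ D i} (x := j) hj)
      · exact ⟨e ⟨x0, hx0⟩, fun h' => absurd h' h⟩
    choose r hr using hD
    have hDc : ∀ i, #(D i) < μ := by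
      intro i
      have h1 : #(Set.Iic i) < μ := by
        rw [← Set.Iio_insert]
        exact (mk_insert_le).trans_lt (add_lt_of_lt (hκ.trans hμ.le) (hIio i)
          (one_lt_aleph0.trans_le (hκ.trans hμ.le)))
      refine lt_of_le_of_lt (whCl_card G κ (max κ #(Set.Iic i)) hκ (le_max_left _ _) _
        (mk_image_le.trans (le_max_right _ _))) (max_lt hμ h1)
    refine wh_LC_of_levels G κ hκ X r ?_ ?_
    · intro i
      refine ih _ ?_ _ rfl
      refine lt_of_le_of_lt (mk_le_mk_of_subset ?_) (hDc i)
      rintro v ⟨hv, rfl⟩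
      exact (hr v hv).1
    · intro v hv
      refine lt_of_le_of_lt (mk_le_mk_of_subset ?_)
        (wh_small G κ hκ hno (⋃ i : Set.Iio (r v), D i) ?_ v ?_)
      · rintro u ⟨hu, huv, h⟩
        exact ⟨Set.mem_iUnion.2 ⟨⟨r u, h⟩, (hr u hu).1⟩, huv⟩
      · intro a ha b hb hab x hx
        obtain ⟨i, hi⟩ := Set.mem_iUnion.1 ha
        obtain ⟨j, hj⟩ := Set.mem_iUnion.1 hb
        refine Set.mem_iUnion.2 ⟨max i j, ?_⟩
        exact whCl_closed G κ _ a (hDm (le_max_left i j) hi) b (hDm (le_max_right i j) hj) hab hx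
      · intro h
        obtain ⟨i, hi⟩ := Set.mem_iUnion.1 h
        exact absurd ((hr v hv).2 _ hi) (not_le.2 i.2)

/-- Assuming the Robertson–Seymour–Thomas structure theorem for the infinite cardinal
`κ`, the weak Hadwiger conjecture holds: if `G` has no proper coloring with `κ` colors,
then `K_κ` is a minor of `G`. -/
theorem weak_hadwiger_of_structure_theorem {V : Type u} (G : SimpleGraph V)
    (κ : Cardinal.{u}) (hκ : Cardinal.aleph0 ≤ κ)
    (hstruct : ¬ HasCompleteTopMinor G κ.out ↔
      ∃ (T : Type u) (_ : PartialOrder T) (inf : T → T → T) (W : T → Set V),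
        WFTreeDecomp inf G W ∧ WidthLT W κ)
    (hnocol : ¬ ∃ c : V → κ.out, ∀ u v : V, G.Adj u v → c u ≠ c v) :
    HasCompleteMinor G κ.out := by
  by_contra hno
  obtain ⟨c, hc⟩ := wh_LC G κ hκ hno _ Set.univ rfl (fun _ => ∅) (fun v _ => by
    simpa using (Cardinal.aleph0_pos.trans_le hκ))
  exact hnocol ⟨c, fun u v huv => (hc v trivial).2 u trivial huv⟩
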